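/- (Lemma 4.1) The cone curvature tensor R̄ satisfies the identity (Ḡ1) if and only if R satisfies both identities (G1) and (G1-1). -/

import Mathlib

open scoped RealInnerProductSpace

/-- The almost complex structure `J̄` of the algebraic cone `V × ℝ` over an almost
contact metric structure `(φ, ξ)`: `J̄(X, s) = (φX + sξ, −η(X))`. -/
noncomputable def Jbar {V : Type*} [NormedAddCommGroup V] [InnerProductSpace ℝ V]
    (φ : V →ₗ[ℝ] V) (ξ : V) : V × ℝ → V × ℝ :=
  fun p => (φ p.1 + p.2 • ξ, -⟪ξ, p.1⟫)

/-- The curvature-like tensor `R̄` of the algebraic cone `V × ℝ`: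
`R̄(X̄,Ȳ,Z̄,W̄) = R(X,Y,Z,W) − g(X,W)g(Y,Z) + g(Y,W)g(X,Z)`. -/
noncomputable def Rbar {V : Type*} [NormedAddCommGroup V] [InnerProductSpace ℝ V]
    (R : V →ₗ[ℝ] V →ₗ[ℝ] V →ₗ[ℝ] V →ₗ[ℝ] ℝ) :
    V × ℝ → V × ℝ → V × ℝ → V × ℝ → ℝ :=
  fun X Y Z W =>
    R X.1 Y.1 Z.1 W.1 - ⟪X.1, W.1⟫ * ⟪Y.1, Z.1⟫ + ⟪Y.1, W.1⟫ * ⟪X.1, Z.1⟫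

/-- In an almost contact metric structure, `φ` is skew-adjoint. -/
theorem inner_phi_right {V : Type*} [NormedAddCommGroup V] [InnerProductSpace ℝ V]
    {φ : V →ₗ[ℝ] V} {ξ : V}
    (hφφ : ∀ X : V, φ (φ X) = -X + ⟪ξ, X⟫ • ξ)
    (hηφ : ∀ X : V, ⟪ξ, φ X⟫ = 0)
    (hg : ∀ X Y : V, ⟪φ X, φ Y⟫ = ⟪X, Y⟫ - ⟪ξ, X⟫ * ⟪ξ, Y⟫) (X Y : V) :
    ⟪X, φ Y⟫ = -⟪φ X, Y⟫ := by
  have h := hg X (φ Y)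
  rw [hφφ, inner_add_right, inner_neg_right, inner_smul_right, real_inner_comm ξ (φ X),
    hηφ, hηφ] at h
  linarith

theorem gray1_cone_iff
    {V : Type*} [NormedAddCommGroup V] [InnerProductSpace ℝ V] [FiniteDimensional ℝ V]
    (n : ℕ) (hn : 1 ≤ n) (hdim : Module.finrank ℝ V = 2 * n + 1)
    (φ : V →ₗ[ℝ] V) (ξ : V)
    (hφφ : ∀ X : V, φ (φ X) = -X + ⟪ξ, X⟫ • ξ)
    (hφξ : φ ξ = 0)
    (hηφ : ∀ X : V, ⟪ξ, φ X⟫ = 0)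
    (hηξ : ⟪ξ, ξ⟫ = (1 : ℝ))
    (hg : ∀ X Y : V, ⟪φ X, φ Y⟫ = ⟪X, Y⟫ - ⟪ξ, X⟫ * ⟪ξ, Y⟫)
    (R : V →ₗ[ℝ] V →ₗ[ℝ] V →ₗ[ℝ] V →ₗ[ℝ] ℝ)
    (hskew₁ : ∀ X Y Z W : V, R X Y Z W = - R Y X Z W)
    (hskew₂ : ∀ X Y Z W : V, R X Y Z W = - R X Y W Z)
    (hsymm : ∀ X Y Z W : V, R X Y Z W = R Z W X Y)
    (hbianchi : ∀ X Y Z W : V, R X Y Z W + R Y Z X W + R Z X Y W = 0)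
    :
    (∀ Xb Yb Zb Wb : V × ℝ,
      Rbar R Xb Yb Zb Wb = Rbar R Xb Yb (Jbar φ ξ Zb) (Jbar φ ξ Wb))
    ↔
    ((∀ X Y Z W : V,
      R X Y Z W - R X Y (φ Z) (φ W)
      = ⟪X, W⟫ * ⟪Y, Z⟫ - ⟪Y, W⟫ * ⟪X, Z⟫
          - ⟪φ X, W⟫ * ⟪φ Y, Z⟫ + ⟪φ Y, W⟫ * ⟪φ X, Z⟫)
    ∧ (∀ X Y W : V, R X Y ξ (φ W) = ⟪ξ, X⟫ * ⟪φ Y, W⟫ - ⟪ξ, Y⟫ * ⟪φ X, W⟫)) := by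
  have hskew := inner_phi_right hφφ hηφ hg
  have hξξ (X Y : V) : R X Y ξ ξ = 0 := by linarith [hskew₂ X Y ξ ξ]
  have hRbar (X Y Z W : V) (s t : ℝ) :
      R X Y (φ Z + s • ξ) (φ W + t • ξ)
          - ⟪X, φ W + t • ξ⟫ * ⟪Y, φ Z + s • ξ⟫ + ⟪Y, φ W + t • ξ⟫ * ⟪X, φ Z + s • ξ⟫
        = R X Y (φ Z) (φ W) - ⟪φ X, W⟫ * ⟪φ Y, Z⟫ + ⟪φ Y, W⟫ * ⟪φ X, Z⟫
          + s * (R X Y ξ (φ W) - (⟪ξ, X⟫ * ⟪φ Y, W⟫ - ⟪ξ, Y⟫ * ⟪φ X, W⟫))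
          - t * (R X Y ξ (φ Z) - (⟪ξ, X⟫ * ⟪φ Y, Z⟫ - ⟪ξ, Y⟫ * ⟪φ X, Z⟫)) := by
    simp only [map_add, map_smul, LinearMap.add_apply, LinearMap.smul_apply, smul_eq_mul,
      inner_add_right, inner_smul_right, hskew, hξξ, hskew₂ X Y (φ Z) ξ,
      real_inner_comm ξ X, real_inner_comm ξ Y]
    ring
  simp only [Rbar, Jbar, hRbar]
  constructor
  · intro h
    have hG1 (X Y Z W : V) := h (X, 0) (Y, 0) (Z, 0) (W, 0)
    refine ⟨fun X Y Z W => ?_, fun X Y W => ?_⟩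
    · linarith [hG1 X Y Z W]
    · linarith [hG1 X Y 0 W, h (X, 0) (Y, 0) (0, 1) (W, 0)]
  · rintro ⟨hG1, hG11⟩ Xb Yb Zb Wb
    rw [hG11, hG11]
    linarith [hG1 Xb.1 Yb.1 Zb.1 Wb.1]
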